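/- arXiv:2407.20953 — 2 statements merged into one kernel-verified Lean document; each statement's English description precedes it below -/
import Mathlib

section
/- Lemma 1.4: Let B ∈ φ(V_D) and i ∈ Z/(D+1) with {i} ∈ B. (1) If g_i(B) = 1, then ε(B − {{i}}) = ε(B) + e_i. (2) If g_i(B) ≥ 2, let I₂ ∈ B be such that i ∈ I₂, I₂ ≠ {i}, and I₂ ⊆ J for every J ∈ B with i ∈ J and J ≠ {i}, and let H, H' ∈ ℐ¹ satisfy H ∩ H' = ∅, H ∪ H' = I₂ − {i}, H ∉ B, H' ∉ B; then ε((B ∪ {H, H'}) − {{i}, I₂}) = ε(B) + e_i. -/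
open scoped BigOperators

/-- `W D` : functions `Z/(D+1) → F₂`. -/
abbrev Wsp (D : ℕ) : Type := ZMod (D + 1) → ZMod 2

/-- The all-ones function. -/
def allOnes (D : ℕ) : Wsp D := fun _ => 1

/-- `V D = W/span{u}`. -/
abbrev Vsp (D : ℕ) : Type := Wsp D ⧸ Submodule.span (ZMod 2) {allOnes D}

/-- `e i` : image of the standard basis function at `i`. -/
def eV (D : ℕ) (i : ZMod (D + 1)) : Vsp D :=
  Submodule.Quotient.mk (Pi.single i 1)

/-- `e_I = ∑_{s ∈ I} e_s`. -/
def eSet (D : ℕ) (I : Finset (ZMod (D + 1))) : Vsp D := ∑ s ∈ I, eV D s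

/-- A cyclic interval (arc): nonempty proper subset of the form `{i, i+1, …, j}`. -/
def IsInterval (D : ℕ) (I : Finset (ZMod (D + 1))) : Prop :=
  ∃ (i : ZMod (D + 1)) (l : ℕ), 1 ≤ l ∧ l ≤ D ∧
    I = (Finset.range l).image (fun t : ℕ => i + (t : ZMod (D + 1)))

/-- Member of `ℐ¹` : interval of odd cardinality. -/
def OddInterval (D : ℕ) (I : Finset (ZMod (D + 1))) : Prop :=
  IsInterval D I ∧ Odd I.card

/-- `I ≺ I'` : `I ⊊ I'` and `I' − I` is a disjoint union of two intervals. -/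
def Prec (D : ℕ) (I I' : Finset (ZMod (D + 1))) : Prop :=
  I ⊂ I' ∧ ∃ I₁ I₂, IsInterval D I₁ ∧ IsInterval D I₂ ∧ Disjoint I₁ I₂ ∧ I' \ I = I₁ ∪ I₂

/-- `I ♠ I'` : `I ∩ I' = ∅` and `I ∪ I'` is not an interval. -/
def Spade (D : ℕ) (I I' : Finset (ZMod (D + 1))) : Prop :=
  I ∩ I' = ∅ ∧ ¬ IsInterval D (I ∪ I')

/-- `I^ev`. -/
noncomputable def evSet (D : ℕ) (I : Finset (ZMod (D + 1))) : Finset (ZMod (D + 1)) :=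
  @Finset.filter _
    (fun i => ∃ I' I'', OddInterval D I' ∧ OddInterval D I'' ∧ Spade D I' I'' ∧
      I.erase i = I' ∪ I'')
    (Classical.decPred _) I

/-- `B ∈ φ(V_D)` : a finite set of elements of `ℐ¹` satisfying (P0) and (P1). -/
def phi (D : ℕ) (B : Finset (Finset (ZMod (D + 1)))) : Prop :=
  (∀ I ∈ B, OddInterval D I) ∧
  (∀ I ∈ B, ∀ I' ∈ B, I = I' ∨ Spade D I I' ∨ Prec D I I' ∨ Prec D I' I) ∧
  (∀ I ∈ B, ∃ 𝒥 : Finset (Finset (ZMod (D + 1))), 𝒥 ⊆ B ∧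
    (∀ J ∈ 𝒥, Prec D J I) ∧
    (∀ J ∈ 𝒥, ∀ J' ∈ 𝒥, J ≠ J' → Disjoint J J') ∧
    evSet D I ⊆ 𝒥.biUnion id)

/-- `⟨B⟩` : the F₂-span of `{e_I : I ∈ B}`. -/
def spanB (D : ℕ) (B : Finset (Finset (ZMod (D + 1)))) : Submodule (ZMod 2) (Vsp D) :=
  Submodule.span (ZMod 2) (eSet D '' ↑B)

/-- `g_i(B) = |{I ∈ B : i ∈ I}|`. -/
def gB (D : ℕ) (B : Finset (Finset (ZMod (D + 1)))) (i : ZMod (D + 1)) : ℕ :=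
  (B.filter (fun I => i ∈ I)).card

/-- `ε(B) = ∑_i (g_i(B)(g_i(B)+1)/2 mod 2) e_i`. -/
def epsB (D : ℕ) (B : Finset (Finset (ZMod (D + 1)))) : Vsp D :=
  ∑ i : ZMod (D + 1), ((gB D B i * (gB D B i + 1) / 2 : ℕ) : ZMod 2) • eV D i

/-- The partial order `B' ≤ B` on `φ(V_D)`. -/
def leφ (D : ℕ) (B' B : Finset (Finset (ZMod (D + 1)))) : Prop :=
  ∃ (k : ℕ) (c : ℕ → Finset (Finset (ZMod (D + 1)))),
    c 0 = B' ∧ c k = B ∧ (∀ s ≤ k, phi D (c s)) ∧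
    ∀ s < k, epsB D (c s) ∈ spanB D (c (s + 1))

/-- `B' < B`. -/
def ltφ (D : ℕ) (B' B : Finset (Finset (ZMod (D + 1)))) : Prop :=
  leφ D B' B ∧ B' ≠ B

/-- `1_E ∈ ℂ[V_D]`, the indicator function of `E ⊆ V_D`. -/
noncomputable def ind (D : ℕ) (E : Set (Vsp D)) : Vsp D → ℂ := E.indicator 1

/-- `δ_x ∈ ℂ[V_D]`. -/
noncomputable def delta (D : ℕ) (x : Vsp D) : Vsp D → ℂ := ind D {x}

/-- The symplectic form on `W`. -/
def formW (D : ℕ) (x y : Wsp D) : ZMod 2 :=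
  ∑ i : ZMod (D + 1), (x i * y (i + 1) + x (i + 1) * y i)

/-- The induced symplectic form on `V_D` (well defined since the form kills `u`). -/
noncomputable def formV (D : ℕ) (x y : Vsp D) : ZMod 2 :=
  formW D (Quotient.out x) (Quotient.out y)

/-- The Fourier transform `ℂ[V_D] → ℂ[V_D]`. -/
noncomputable def fourierV (D : ℕ) (f : Vsp D → ℂ) : Vsp D → ℂ :=
  fun y => (2 : ℂ) ^ (-((D / 2 : ℕ) : ℤ)) *
    ∑ᶠ x : Vsp D, (if formV D x y = 0 then (1 : ℂ) else -1) * f x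

/-- The target in `V_D` of the basis vector `e'_ℓ` of `V_{D-2}` under `τ_j`. -/
noncomputable def tauTgt (D j : ℕ) (ℓ : ZMod (D - 2 + 1)) : Vsp D :=
  let L : ℕ := if ℓ.val = 0 then D - 1 else ℓ.val
  if ℓ = ((j - 1 : ℕ) : ZMod (D - 2 + 1)) then
    eV D ((j : ZMod (D + 1)) - 1) + eV D (j : ZMod (D + 1)) + eV D ((j : ZMod (D + 1)) + 1)
  else if L < j - 1 then eV D (L : ZMod (D + 1))
  else eV D ((L + 2 : ℕ) : ZMod (D + 1))

/-- The linear embedding `τ_j : V_{D-2} → V_D` (well defined independently of the chosen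
representative since the targets sum to `0`). -/
noncomputable def tauMap (D j : ℕ) (x : Vsp (D - 2)) : Vsp D :=
  ∑ i : ZMod (D - 2 + 1), (Quotient.out x) i • tauTgt D j i

theorem gB_insert (D : ℕ) {B : Finset (Finset (ZMod (D + 1)))} {I : Finset (ZMod (D + 1))}
    (hI : I ∉ B) (j : ZMod (D + 1)) :
    gB D (insert I B) j = gB D B j + if j ∈ I then 1 else 0 := by
  simp only [gB, Finset.card_filter]
  rw [Finset.sum_insert hI, add_comm]

theorem gB_erase_add (D : ℕ) {B : Finset (Finset (ZMod (D + 1)))} {I : Finset (ZMod (D + 1))}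
    (hI : I ∈ B) (j : ZMod (D + 1)) :
    gB D (B.erase I) j + (if j ∈ I then 1 else 0) = gB D B j := by
  rw [← gB_insert D (Finset.notMem_erase I B), Finset.insert_erase hI]

theorem epsB_eq_add_eV (D : ℕ) {B B' : Finset (Finset (ZMod (D + 1)))} (i : ZMod (D + 1))
    (hne : ∀ j ≠ i, gB D B' j = gB D B j)
    (hi : ((gB D B' i * (gB D B' i + 1) / 2 : ℕ) : ZMod 2) =
      ((gB D B i * (gB D B i + 1) / 2 : ℕ) : ZMod 2) + 1) :
    epsB D B' = epsB D B + eV D i := by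
  unfold epsB
  rw [← Finset.add_sum_erase _ _ (Finset.mem_univ i), hi,
    ← Finset.add_sum_erase Finset.univ (fun j => ((gB D B j * (gB D B j + 1) / 2 : ℕ) : ZMod 2) •
      eV D j) (Finset.mem_univ i),
    Finset.sum_congr rfl fun j hj => by rw [hne j (Finset.ne_of_mem_erase hj)],
    add_smul, one_smul]
  abel

theorem triangular_add_two_cast (n : ℕ) :
    ((n * (n + 1) / 2 : ℕ) : ZMod 2) = (((n + 2) * (n + 2 + 1) / 2 : ℕ) : ZMod 2) + 1 := by
  have h : (n + 2) * (n + 2 + 1) / 2 = n * (n + 1) / 2 + (2 * n + 3) := by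
    rw [show (n + 2) * (n + 2 + 1) = n * (n + 1) + (2 * n + 3) * 2 by ring,
      Nat.add_mul_div_right _ _ two_pos]
  have h4 : (4 : ZMod 2) = 0 := rfl
  have h2 : (2 : ZMod 2) = 0 := rfl
  rw [h]
  push_cast
  linear_combination -(n : ZMod 2) * h2 - h4

theorem OddInterval.nonempty {D : ℕ} {I : Finset (ZMod (D + 1))} (hI : OddInterval D I) :
    I.Nonempty :=
  Finset.card_pos.mp hI.2.pos

/-- Lemma 1.4: if `{i} ∈ B ∈ φ(V_D)` then (1) if `g_i(B) = 1`,
`ε(B − {{i}}) = ε(B) + e_i`; (2) if `g_i(B) ≥ 2`, `I₂` is the smallest element of `B`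
containing `i` other than `{i}`, and `H ⊔ H' = I₂ − {i}` with `H, H' ∈ ℐ¹` not in `B`,
then `ε((B ∪ {H, H'}) − {{i}, I₂}) = ε(B) + e_i`. -/
theorem lemma_1_4 (D : ℕ) (hD : 2 ≤ D) (hDev : Even D)
    (B : Finset (Finset (ZMod (D + 1)))) (hB : phi D B) (i : ZMod (D + 1))
    (hi : {i} ∈ B) :
    (gB D B i = 1 → epsB D (B.erase {i}) = epsB D B + eV D i) ∧
    (2 ≤ gB D B i →
      ∀ I₂ ∈ B, i ∈ I₂ → I₂ ≠ {i} → (∀ J ∈ B, i ∈ J → J ≠ {i} → I₂ ⊆ J) →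
      ∀ H H' : Finset (ZMod (D + 1)), OddInterval D H → OddInterval D H' →
        H ∩ H' = ∅ → H ∪ H' = I₂.erase i → H ∉ B → H' ∉ B →
        epsB D ((B ∪ {H, H'}) \ {({i} : Finset (ZMod (D + 1))), I₂}) =
          epsB D B + eV D i) := by
  refine ⟨fun hg => ?_, fun _ I₂ hI₂ hiI₂ hne _ H H' hH hH' hdisj hunion hHB hH'B => ?_⟩
  · refine epsB_eq_add_eV D i (fun j hj => ?_) ?_
    · simpa [hj] using gB_erase_add D hi j
    · have h := gB_erase_add D hi i
      have h0 : gB D (B.erase {i}) i = 0 := by simp at h; omega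
      rw [h0, hg]
      rfl
  · have hHH' : H ≠ H' := by
      rintro rfl
      exact hH.nonempty.ne_empty (by simpa using hdisj)
    have hI₂' : I₂ ∈ B.erase {i} := Finset.mem_erase.mpr ⟨hne, hI₂⟩
    have hset : (B ∪ {H, H'}) \ {({i} : Finset (ZMod (D + 1))), I₂} =
        insert H (insert H' ((B.erase {i}).erase I₂)) := by
      ext J
      have h₁ : H ≠ {i} := fun h => hHB (h ▸ hi)
      have h₂ : H' ≠ {i} := fun h => hH'B (h ▸ hi)
      have h₃ : H ≠ I₂ := fun h => hHB (h ▸ hI₂)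
      have h₄ : H' ≠ I₂ := fun h => hH'B (h ▸ hI₂)
      simp only [Finset.mem_sdiff, Finset.mem_union, Finset.mem_insert, Finset.mem_singleton,
        Finset.mem_erase]
      grind
    have hg (j : ZMod (D + 1)) := gB_erase_add D hi j
    have hg₂ (j : ZMod (D + 1)) := gB_erase_add D hI₂' j
    have hg' (j : ZMod (D + 1)) :
        gB D ((B ∪ {H, H'}) \ {({i} : Finset (ZMod (D + 1))), I₂}) j =
          gB D ((B.erase {i}).erase I₂) j + (if j ∈ H' then 1 else 0) +
            (if j ∈ H then 1 else 0) := by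
      rw [hset, gB_insert D (by simp [hHB, hHH']), gB_insert D (by simp [hH'B])]
    have hmem (j : ZMod (D + 1)) : j ∈ H ∨ j ∈ H' ↔ j ≠ i ∧ j ∈ I₂ := by
      rw [← Finset.mem_union, hunion, Finset.mem_erase]
    have hnot (j : ZMod (D + 1)) : ¬(j ∈ H ∧ j ∈ H') := by
      rw [← Finset.mem_inter, hdisj]
      exact Finset.notMem_empty j
    refine epsB_eq_add_eV D i (fun j hj => ?_) ?_
    · have := hg j
      have := hg₂ j
      have := hg' j
      have := hmem j
      have := hnot j
      simp only [Finset.mem_singleton] at *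
      grind
    · have h : gB D B i =
          gB D ((B ∪ {H, H'}) \ {({i} : Finset (ZMod (D + 1))), I₂}) i + 2 := by
        have := hg i
        have := hg₂ i
        have := hg' i
        have := hmem i
        simp only [Finset.mem_singleton] at *
        grind
      rw [h]
      exact triangular_add_two_cast _
end

section
/- Lemma 1.5: For B ∈ φ(V_D) and i ∈ Z/(D+1), the following are equivalent: (1) {i} ∈ B; (2) g_i(B) ≥ 1 and g_{i−1}(B) = g_i(B) − 1 and g_{i+1}(B) = g_i(B) − 1 (indices taken mod D+1). -/
open scoped BigOperators

/-- The arc `{a, a+1, …, a+l-1}` of `Z/(D+1)`. -/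
def arc (D : ℕ) (a : ZMod (D + 1)) (l : ℕ) : Finset (ZMod (D + 1)) :=
  (Finset.range l).image (fun t : ℕ => a + (t : ZMod (D + 1)))

section Arc

variable {D : ℕ}

lemma natCast_zmod_inj {s t : ℕ} (hs : s ≤ D) (ht : t ≤ D)
    (h : (s : ZMod (D + 1)) = t) : s = t := by
  have := congrArg ZMod.val h
  rwa [ZMod.val_cast_of_lt (by omega), ZMod.val_cast_of_lt (by omega)] at this

lemma mem_arc {a x : ZMod (D + 1)} {l : ℕ} : x ∈ arc D a l ↔ ∃ t < l, x = a + (t : ℕ) := by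
  simp [arc, eq_comm]

lemma add_mem_arc {a : ZMod (D + 1)} {l t : ℕ} (hl : l ≤ D + 1) (ht : t ≤ D) :
    a + (t : ZMod (D + 1)) ∈ arc D a l ↔ t < l := by
  refine ⟨fun h => ?_, fun h => mem_arc.2 ⟨t, h, rfl⟩⟩
  obtain ⟨s, hs, e⟩ := mem_arc.1 h
  have := natCast_zmod_inj ht (by omega) (add_left_cancel e)
  omega

lemma card_arc {a : ZMod (D + 1)} {l : ℕ} (hl : l ≤ D + 1) : (arc D a l).card = l := by
  unfold arc
  rw [Finset.card_image_of_injOn, Finset.card_range]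
  intro s hs t ht e
  simp only [Finset.coe_range, Set.mem_Iio] at hs ht
  exact natCast_zmod_inj (by omega) (by omega) (add_left_cancel e)

lemma isInterval_arc {a : ZMod (D + 1)} {l : ℕ} (h1 : 1 ≤ l) (hl : l ≤ D) :
    IsInterval D (arc D a l) := ⟨a, l, h1, hl, rfl⟩

lemma oddInterval_arc {a : ZMod (D + 1)} {l : ℕ} (ho : Odd l) (hl : l ≤ D) :
    OddInterval D (arc D a l) :=
  ⟨isInterval_arc ho.pos hl, by rwa [card_arc (by omega)]⟩

lemma OddInterval.exists_arc {I : Finset (ZMod (D + 1))} (h : OddInterval D I) :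
    ∃ a l, Odd l ∧ l ≤ D ∧ I = arc D a l := by
  obtain ⟨⟨a, l, -, hl, rfl⟩, ho⟩ := h
  exact ⟨a, l, by rwa [← arc, card_arc (by omega)] at ho, hl, rfl⟩

lemma eq_of_mem_arc_of_succ_notMem {a x : ZMod (D + 1)} {l : ℕ} (hx : x ∈ arc D a l)
    (hx' : x + 1 ∉ arc D a l) : x + 1 = a + (l : ℕ) := by
  obtain ⟨t, ht, rfl⟩ := mem_arc.1 hx
  have : t + 1 = l := by
    by_contra hne
    exact hx' (mem_arc.2 ⟨t + 1, by omega, by push_cast; ring⟩)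
  subst this
  push_cast; ring

lemma eq_of_succ_mem_arc_of_notMem {a x : ZMod (D + 1)} {l : ℕ} (hx : x + 1 ∈ arc D a l)
    (hx' : x ∉ arc D a l) : x + 1 = a := by
  obtain ⟨t, ht, e⟩ := mem_arc.1 hx
  cases t with
  | zero => simpa using e
  | succ t =>
    refine absurd (mem_arc.2 ⟨t, by omega, ?_⟩) hx'
    push_cast at e
    linear_combination e

lemma arc_union_arc (a : ZMod (D + 1)) (l m : ℕ) :
    arc D a l ∪ arc D (a + (l : ℕ)) m = arc D a (l + m) := by
  ext x
  simp only [Finset.mem_union, mem_arc]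
  constructor
  · rintro (⟨t, ht, rfl⟩ | ⟨t, ht, rfl⟩)
    · exact ⟨t, by omega, rfl⟩
    · exact ⟨l + t, by omega, by push_cast; ring⟩
  · rintro ⟨t, ht, rfl⟩
    by_cases h : t < l
    · exact Or.inl ⟨t, h, rfl⟩
    · refine Or.inr ⟨t - l, by omega, ?_⟩
      rw [add_assoc, ← Nat.cast_add, Nat.add_sub_cancel' (by omega)]

/-- Two disjoint adjacent odd arcs are not `♠`-related. -/
lemma isInterval_union_of_adjacent (hD : Even D) {I J : Finset (ZMod (D + 1))}
    (hI : OddInterval D I) (hJ : OddInterval D J) (hd : I ∩ J = ∅) {x : ZMod (D + 1)}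
    (hx : x ∈ I) (hx' : x + 1 ∈ J) : IsInterval D (I ∪ J) := by
  obtain ⟨a, l, hlo, hl, rfl⟩ := hI.exists_arc
  obtain ⟨b, m, hmo, hm, rfl⟩ := hJ.exists_arc
  rw [← Finset.disjoint_iff_inter_eq_empty] at hd
  have e1 := eq_of_mem_arc_of_succ_notMem hx (Finset.disjoint_right.1 hd hx')
  have e2 := eq_of_succ_mem_arc_of_notMem hx' (Finset.disjoint_left.1 hd hx)
  have hc := Finset.card_le_univ (arc D a l ∪ arc D b m)
  rw [Finset.card_union_of_disjoint hd, card_arc (by omega), card_arc (by omega),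
    ZMod.card] at hc
  obtain rfl : b = a + (l : ℕ) := e2.symm.trans e1
  rw [arc_union_arc]
  refine isInterval_arc (by have := hlo.pos; omega) ?_
  have := hlo.add_odd hmo
  grind

lemma mem_evSet_arc {a : ZMod (D + 1)} {l t : ℕ} (hlo : Odd l) (hl : l ≤ D)
    (hto : Odd t) (ht : t < l) : a + (t : ZMod (D + 1)) ∈ evSet D (arc D a l) := by
  classical
  have h1 : Odd (l - t - 1) := by grind
  have hpos := h1.pos
  have hsplit : arc D a l = arc D a t ∪ arc D (a + (t : ℕ)) (1 + (l - t - 1)) := by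
    rw [arc_union_arc]; congr 1; omega
  have herase : (arc D a l).erase (a + (t : ℕ)) =
      arc D a t ∪ arc D (a + ((t + 1 : ℕ) : ZMod (D + 1))) (l - t - 1) := by
    ext x
    simp only [Finset.mem_erase, Finset.mem_union, mem_arc]
    constructor
    · rintro ⟨hne, s, hs, rfl⟩
      rcases lt_trichotomy s t with h | rfl | h
      · exact Or.inl ⟨s, h, rfl⟩
      · exact absurd rfl hne
      · refine Or.inr ⟨s - (t + 1), by omega, ?_⟩
        rw [add_assoc, ← Nat.cast_add, Nat.add_sub_cancel' (by omega)]
    · rintro (⟨s, hs, rfl⟩ | ⟨s, hs, rfl⟩)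
      · refine ⟨fun e => ?_, s, by omega, rfl⟩
        have := natCast_zmod_inj (by omega) (by omega) (add_left_cancel e)
        omega
      · rw [add_assoc, ← Nat.cast_add]
        refine ⟨fun e => ?_, _, by omega, rfl⟩
        have := natCast_zmod_inj (by omega) (by omega) (add_left_cancel e)
        omega
  simp only [evSet, Finset.mem_filter]
  refine ⟨(add_mem_arc (by omega) (by omega)).2 ht, _, _, oddInterval_arc hto (by omega),
    oddInterval_arc h1 (by omega), ⟨?_, ?_⟩, herase⟩
  · rw [← Finset.disjoint_iff_inter_eq_empty, Finset.disjoint_left]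
    intro x hx hx'
    obtain ⟨s, hs, rfl⟩ := mem_arc.1 hx
    obtain ⟨r, hr, e⟩ := mem_arc.1 hx'
    rw [add_assoc, ← Nat.cast_add] at e
    have := natCast_zmod_inj (by omega) (by omega) (add_left_cancel e)
    omega
  · rw [← herase]
    rintro ⟨b, m, -, hm, e⟩
    change _ = arc D b m at e
    have end_eq : ∀ s, s + 1 = t ∨ s + 1 = l →
        a + ((s + 1 : ℕ) : ZMod (D + 1)) = b + (m : ℕ) := by
      intro s hs
      have hin : a + (s : ZMod (D + 1)) ∈ arc D b m := by
        rw [← e, Finset.mem_erase, add_mem_arc (by omega) (by omega)]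
        refine ⟨fun e => ?_, by omega⟩
        have := natCast_zmod_inj (by omega) (by omega) (add_left_cancel e)
        omega
      have hout : a + (s : ZMod (D + 1)) + 1 ∉ arc D b m := by
        rw [← e, Finset.mem_erase, add_assoc, ← Nat.cast_succ,
          add_mem_arc (by omega) (by omega)]
        rintro ⟨hne, hlt⟩
        rcases hs with rfl | rfl
        · exact hne rfl
        · omega
      have := eq_of_mem_arc_of_succ_notMem hin hout
      rwa [add_assoc, ← Nat.cast_succ] at this
    have htpos := hto.pos
    have h2 := (end_eq (t - 1) (by omega)).trans (end_eq (l - 1) (by omega)).symm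
    have := natCast_zmod_inj (by omega) (by omega) (add_left_cancel h2)
    omega

end Arc

section Phi

variable {D : ℕ} {B : Finset (Finset (ZMod (D + 1)))}

lemma phi.trichotomy (hB : phi D B) {I J : Finset (ZMod (D + 1))} (hI : I ∈ B) (hJ : J ∈ B) :
    I = J ∨ Spade D I J ∨ I ⊂ J ∨ J ⊂ I := by
  rcases hB.2.1 I hI J hJ with h | h | h | h
  · exact Or.inl h
  · exact Or.inr (Or.inl h)
  · exact Or.inr (Or.inr (Or.inl h.1))
  · exact Or.inr (Or.inr (Or.inr h.1))

lemma phi.comparable (hB : phi D B) {I J : Finset (ZMod (D + 1))} (hI : I ∈ B) (hJ : J ∈ B)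
    {x : ZMod (D + 1)} (hxI : x ∈ I) (hxJ : x ∈ J) : I = J ∨ I ⊂ J ∨ J ⊂ I := by
  rcases hB.trichotomy hI hJ with h | h | h
  · exact Or.inl h
  · have : x ∈ I ∩ J := Finset.mem_inter.2 ⟨hxI, hxJ⟩
    simp [h.1] at this
  · exact Or.inr h

lemma phi.ssubset_of_succ_mem (hB : phi D B) (hD : Even D) {I J : Finset (ZMod (D + 1))}
    (hI : I ∈ B) (hJ : J ∈ B) {x : ZMod (D + 1)} (h1 : x ∈ I) (h2 : x + 1 ∉ I)
    (h3 : x + 1 ∈ J) : I ⊂ J := by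
  rcases hB.trichotomy hI hJ with rfl | h | h | h
  · exact absurd h3 h2
  · exact absurd (isInterval_union_of_adjacent hD (hB.1 I hI) (hB.1 J hJ) h.1 h1 h3) h.2
  · exact h
  · exact absurd (h.1 h3) h2

lemma phi.ssubset_of_mem_of_succ (hB : phi D B) (hD : Even D) {I J : Finset (ZMod (D + 1))}
    (hI : I ∈ B) (hJ : J ∈ B) {x : ZMod (D + 1)} (h1 : x + 1 ∈ I) (h2 : x ∉ I)
    (h3 : x ∈ J) : I ⊂ J := by
  rcases hB.trichotomy hJ hI with rfl | h | h | h
  · exact absurd h3 h2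
  · exact absurd (isInterval_union_of_adjacent hD (hB.1 J hJ) (hB.1 I hI) h.1 h3 h1) h.2
  · exact absurd (h.1 h3) h2
  · exact h

lemma phi.exists_cover (hB : phi D B) {a : ZMod (D + 1)} {l t : ℕ} (hlo : Odd l) (hl : l ≤ D)
    (hI : arc D a l ∈ B) (hto : Odd t) (ht : t < l) :
    ∃ K ∈ B, K ⊂ arc D a l ∧ a + (t : ZMod (D + 1)) ∈ K := by
  obtain ⟨𝒥, hsub, hprec, -, hcov⟩ := hB.2.2 _ hI
  obtain ⟨K, hK, hmem⟩ := Finset.mem_biUnion.1 (hcov (mem_evSet_arc (a := a) hlo hl hto ht))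
  exact ⟨K, hsub hK, (hprec K hK).1, hmem⟩

/-- A proper subinterval in `B` avoids the left end of the larger one. -/
lemma phi.left_mem (hB : phi D B) (hD : Even D) {I J : Finset (ZMod (D + 1))}
    (hI : I ∈ B) (hJ : J ∈ B) (hJI : J ⊂ I) {x : ZMod (D + 1)} (hx : x + 1 ∈ J) : x ∈ I := by
  by_contra hxI
  obtain ⟨K, hK, hmax⟩ := Finset.exists_max_image
    (B.filter fun K => K ⊂ I ∧ x + 1 ∈ K) Finset.card ⟨J, by simp [hJ, hJI, hx]⟩
  simp only [Finset.mem_filter] at hK hmax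
  obtain ⟨hKB, hKI, hxK⟩ := hK
  obtain ⟨a, l, hlo, hl, rfl⟩ := (hB.1 I hI).exists_arc
  obtain ⟨b, m, hmo, hm, rfl⟩ := (hB.1 K hKB).exists_arc
  have ea := eq_of_succ_mem_arc_of_notMem (hKI.1 hxK) hxI
  have eb := eq_of_succ_mem_arc_of_notMem hxK (fun h => hxI (hKI.1 h))
  obtain rfl : b = a := eb.symm.trans ea
  have hcard := Finset.card_lt_card hKI
  rw [card_arc (by omega), card_arc (by omega)] at hcard
  obtain ⟨L, hLB, hLI, hL⟩ := hB.exists_cover hlo hl hI hmo hcard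
  have hmpos := hmo.pos
  have hs : b + ((m - 1 : ℕ) : ZMod (D + 1)) + 1 = b + (m : ℕ) := by
    rw [add_assoc, ← Nat.cast_succ, Nat.succ_eq_add_one, Nat.sub_add_cancel hmpos]
  have hKL := hB.ssubset_of_succ_mem hD hKB hLB (x := b + ((m - 1 : ℕ) : ZMod (D + 1)))
    ((add_mem_arc (by omega) (by omega)).2 (by omega))
    (by rw [hs, add_mem_arc (by omega) (by omega)]; omega) (by rwa [hs])
  exact absurd (hmax L ⟨hLB, hLI, hKL.1 hxK⟩) (not_le.2 (Finset.card_lt_card hKL))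

/-- A proper subinterval in `B` avoids the right end of the larger one. -/
lemma phi.right_mem (hB : phi D B) (hD : Even D) {I J : Finset (ZMod (D + 1))}
    (hI : I ∈ B) (hJ : J ∈ B) (hJI : J ⊂ I) {x : ZMod (D + 1)} (hx : x ∈ J) : x + 1 ∈ I := by
  by_contra hxI
  obtain ⟨K, hK, hmax⟩ := Finset.exists_max_image
    (B.filter fun K => K ⊂ I ∧ x ∈ K) Finset.card ⟨J, by simp [hJ, hJI, hx]⟩
  simp only [Finset.mem_filter] at hK hmax
  obtain ⟨hKB, hKI, hxK⟩ := hK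
  obtain ⟨a, l, hlo, hl, rfl⟩ := (hB.1 I hI).exists_arc
  obtain ⟨b, m, hmo, hm, rfl⟩ := (hB.1 K hKB).exists_arc
  have ea := eq_of_mem_arc_of_succ_notMem (hKI.1 hxK) hxI
  have eb := eq_of_mem_arc_of_succ_notMem hxK (fun h => hxI (hKI.1 h))
  have hcard := Finset.card_lt_card hKI
  rw [card_arc (by omega), card_arc (by omega)] at hcard
  have hto : Odd (l - m - 1) := by grind
  obtain ⟨L, hLB, hLI, hL⟩ := hB.exists_cover hlo hl hI hto (by omega)
  have hs : a + ((l - m - 1 : ℕ) : ZMod (D + 1)) + 1 = b := by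
    have e : ((l - m - 1 + 1 + m : ℕ) : ZMod (D + 1)) = (l : ℕ) := by congr 1; omega
    push_cast at e
    linear_combination e + eb - ea
  have hKL := hB.ssubset_of_mem_of_succ hD hKB hLB
    (x := a + ((l - m - 1 : ℕ) : ZMod (D + 1)))
    (by
      rw [hs]
      simpa using (add_mem_arc (a := b) (l := m) (t := 0) (by omega) (by omega)).2 hmo.pos)
    (by
      intro h
      obtain ⟨t, ht, e⟩ := mem_arc.1 h
      rw [← hs, add_assoc, add_assoc, add_comm (1 : ZMod (D + 1)), ← Nat.cast_succ,
        ← Nat.cast_add] at e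
      have := natCast_zmod_inj (by omega) (by omega) (add_left_cancel e)
      omega)
    hL
  exact absurd (hmax L ⟨hLB, hLI, hKL.1 hxK⟩) (not_le.2 (Finset.card_lt_card hKL))

lemma singleton_ssubset_of_mem_of_ne {I : Finset (ZMod (D + 1))} {i : ZMod (D + 1)}
    (hiI : i ∈ I) (hne : I ≠ {i}) : {i} ⊂ I :=
  (Finset.singleton_subset_iff.2 hiI).ssubset_of_ne hne.symm

lemma gB_eq_pred_of_singleton_mem {i y : ZMod (D + 1)} (hi : {i} ∈ B)
    (h : ∀ I ∈ B, y ∈ I ↔ i ∈ I ∧ I ≠ {i}) : gB D B y = gB D B i - 1 := by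
  have : B.filter (fun I => y ∈ I) = (B.filter (fun I => i ∈ I)).erase {i} := by
    ext I
    simp only [Finset.mem_filter, Finset.mem_erase]
    constructor
    · rintro ⟨hI, hy⟩
      exact ⟨((h I hI).1 hy).2, hI, ((h I hI).1 hy).1⟩
    · rintro ⟨hne, hI, hi⟩
      exact ⟨hI, (h I hI).2 ⟨hi, hne⟩⟩
  rw [gB, this, Finset.card_erase_of_mem (by simp [hi]), gB]

/-- If `C` is the smallest member of `B` containing `i` and `K ⊂ C` lies in `B`, then every
`y ∈ K` satisfies `g_i(B) < g_y(B)`. -/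
lemma phi.gB_lt (hB : phi D B) {C K : Finset (ZMod (D + 1))} {i y : ZMod (D + 1)}
    (hC : C ∈ B) (hiC : i ∈ C) (hmin : ∀ I ∈ B, i ∈ I → C.card ≤ I.card)
    (hK : K ∈ B) (hKC : K ⊂ C) (hy : y ∈ K) : gB D B i < gB D B y := by
  refine Finset.card_lt_card (Finset.ssubset_iff_of_subset ?_ |>.2 ⟨K, by simp [hK, hy], ?_⟩)
  · intro I hI
    simp only [Finset.mem_filter] at hI ⊢
    refine ⟨hI.1, ?_⟩
    rcases hB.comparable hC hI.1 hiC hI.2 with rfl | h | h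
    · exact hKC.1 hy
    · exact h.1 (hKC.1 hy)
    · exact absurd (Finset.card_lt_card h) (not_lt.2 (hmin I hI.1 hI.2))
  · simp only [Finset.mem_filter, not_and]
    exact fun _ h => absurd (Finset.card_lt_card hKC) (not_lt.2 (hmin K hK h))

end Phi

/-- Lemma 1.5: `{i} ∈ B` iff `g_i(B) ≥ 1` and `g_{i−1}(B) = g_{i+1}(B) = g_i(B) − 1`. -/
theorem lemma_1_5 (D : ℕ) (hD : 2 ≤ D) (hDev : Even D)
    (B : Finset (Finset (ZMod (D + 1)))) (hB : phi D B) (i : ZMod (D + 1)) :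
    {i} ∈ B ↔
      (1 ≤ gB D B i ∧ gB D B (i - 1) = gB D B i - 1 ∧ gB D B (i + 1) = gB D B i - 1) := by
  constructor
  · intro hi
    have h10 : (1 : ZMod (D + 1)) ≠ 0 := by
      intro h
      have := natCast_zmod_inj (D := D) (s := 1) (t := 0) (by omega) (by omega) (by simpa using h)
      omega
    refine ⟨Finset.card_pos.2 ⟨{i}, by simp [hi]⟩,
      gB_eq_pred_of_singleton_mem hi fun I hI => ⟨fun hy => ?_, fun h => ?_⟩,
      gB_eq_pred_of_singleton_mem hi fun I hI => ⟨fun hy => ?_, fun h => ?_⟩⟩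
    · have hs := hB.ssubset_of_mem_of_succ hDev hi hI (x := i - 1) (by simp)
        (by simpa using h10) hy
      exact ⟨hs.1 (by simp), hs.ne'⟩
    · exact hB.left_mem hDev hI hi (singleton_ssubset_of_mem_of_ne h.1 h.2) (by simp)
    · have hs := hB.ssubset_of_succ_mem hDev hi hI (x := i) (by simp) (by simpa using h10) hy
      exact ⟨hs.1 (by simp), hs.ne'⟩
    · exact hB.right_mem hDev hI hi (singleton_ssubset_of_mem_of_ne h.1 h.2) (by simp)
  · rintro ⟨h1, hl, hr⟩
    obtain ⟨C, hC, hmin⟩ := Finset.exists_min_image (B.filter fun I => i ∈ I) Finset.card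
      (Finset.card_pos.1 h1)
    simp only [Finset.mem_filter, and_imp] at hC hmin
    obtain ⟨hCB, hiC⟩ := hC
    obtain ⟨a, l, hlo, hlD, rfl⟩ := (hB.1 C hCB).exists_arc
    have hcover : ∀ s, Odd s → s < l → gB D B i < gB D B (a + (s : ℕ)) := by
      intro s hs hsl
      obtain ⟨K, hKB, hKC, hK⟩ := hB.exists_cover hlo hlD hCB hs hsl
      exact hB.gB_lt hCB hiC hmin hKB hKC hK
    obtain ⟨t, ht, rfl⟩ := mem_arc.1 hiC
    rcases Nat.even_or_odd t with hte | hto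
    · by_cases htl : t + 1 < l
      · have := hcover (t + 1) hte.add_one htl
        rw [Nat.cast_add, Nat.cast_one, ← add_assoc, hr] at this
        omega
      · rcases Nat.eq_zero_or_pos t with rfl | htp
        · obtain rfl : l = 1 := by omega
          simpa [arc] using hCB
        · have := hcover (t - 1) (by grind) (by omega)
          rw [Nat.cast_sub htp, Nat.cast_one, ← add_sub_assoc, hl] at this
          omega
    · exact absurd (hcover t hto ht) (lt_irrefl _)
end
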